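/- There is no frame function on the set 𝓕 of all frames in ℝ³; that is, there is no function λ : 𝓕 → T, where T = {(1,1,0),(1,0,1),(0,1,1)}, such that whenever two frames 𝐚 = (a₁,a₂,a₃) and 𝐚' = (a'₁,a'₂,a'₃) in 𝓕 satisfy aᵢ = ±a'ⱼ for some indices i, j, one has λᵢ(𝐚) = λⱼ(𝐚'). -/

import Mathlib

noncomputable section

/-- Euclidean ℝ³. -/
abbrev V3 : Type := EuclideanSpace ℝ (Fin 3)

/-- A frame in ℝ³: an ordered orthonormal basis (an orthonormal triple is automatically
a basis of ℝ³). -/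
abbrev Frame : Type := {a : Fin 3 → V3 // Orthonormal ℝ a}

/-- Two unit vectors span the same line iff they are equal up to sign. -/
def SameLine (u v : V3) : Prop := u = v ∨ u = -v

/-- The set T = {(1,1,0),(1,0,1),(0,1,1)} of possible outcome triples. -/
def Tset : Set (Fin 3 → ℕ) := {![1, 1, 0], ![1, 0, 1], ![0, 1, 1]}


/-- The combinatorial core: a Kochen-Specker colouring of integer vectors is impossible. -/
theorem ks_core (Z : ℤ → ℤ → ℤ → Prop)
    (pair : ∀ {a b c d e f : ℤ}, (¬ (a = 0 ∧ b = 0 ∧ c = 0) ∧ ¬ (d = 0 ∧ e = 0 ∧ f = 0) ∧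
      a * d + b * e + c * f = 0) → Z a b c → ¬ Z d e f)
    (tri : ∀ {a b c d e f g h k : ℤ}, (¬ (a = 0 ∧ b = 0 ∧ c = 0) ∧
      ¬ (d = 0 ∧ e = 0 ∧ f = 0) ∧ ¬ (g = 0 ∧ h = 0 ∧ k = 0) ∧ a * d + b * e + c * f = 0 ∧
      a * g + b * h + c * k = 0 ∧ d * g + e * h + f * k = 0) →
      ¬ Z a b c → ¬ Z d e f → Z g h k) : False := by
  by_cases h0_0_1 : Z 0 0 1
  · by_cases h0_1_m1 : Z 0 1 (-1)
    · have h0_1_0 : ¬ Z 0 1 0 := pair (by decide) h0_0_1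
      have h1_m1_0 : ¬ Z 1 (-1) 0 := pair (by decide) h0_0_1
      have h1_1_0 : ¬ Z 1 1 0 := pair (by decide) h0_0_1
      have h0_1_1 : ¬ Z 0 1 1 := pair (by decide) h0_1_m1
      have h1_m1_m1 : ¬ Z 1 (-1) (-1) := pair (by decide) h0_1_m1
      have h1_1_1 : ¬ Z 1 1 1 := pair (by decide) h0_1_m1
      have h1_2_2 : ¬ Z 1 2 2 := pair (by decide) h0_1_m1
      have h1_1_m2 : Z 1 1 (-2) := tri (by decide) h1_m1_0 h1_1_1
      have h1_m1_2 : Z 1 (-1) 2 := tri (by decide) h1_m1_m1 h1_1_0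
      have h2_0_1 : ¬ Z 2 0 1 := pair (by decide) h1_1_m2
      have h2_0_m1 : ¬ Z 2 0 (-1) := pair (by decide) h1_m1_2
      have h1_0_m2 : Z 1 0 (-2) := tri (by decide) h0_1_0 h2_0_1
      have h1_0_2 : Z 1 0 2 := tri (by decide) h0_1_0 h2_0_m1
      have h2_m2_1 : ¬ Z 2 (-2) 1 := pair (by decide) h1_0_m2
      have h2_1_m1 : ¬ Z 2 1 (-1) := pair (by decide) h1_0_2
      have h2_1_m2 : Z 2 1 (-2) := tri (by decide) h1_2_2 h2_m2_1
      have h1_m1_1 : Z 1 (-1) 1 := tri (by decide) h0_1_1 h2_1_m1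
      have h1_0_1 : ¬ Z 1 0 1 := pair (by decide) h2_1_m2
      have h1_0_m1 : ¬ Z 1 0 (-1) := pair (by decide) h1_m1_1
      exact h1_0_1 (tri (by decide) h0_1_0 h1_0_m1)
    by_cases h0_1_1 : Z 0 1 1
    · have h0_1_0 : ¬ Z 0 1 0 := pair (by decide) h0_0_1
      have h1_m1_0 : ¬ Z 1 (-1) 0 := pair (by decide) h0_0_1
      have h1_1_0 : ¬ Z 1 1 0 := pair (by decide) h0_0_1
      have h0_1_m1 : ¬ Z 0 1 (-1) := pair (by decide) h0_1_1
      have h1_m1_1 : ¬ Z 1 (-1) 1 := pair (by decide) h0_1_1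
      have h1_1_m1 : ¬ Z 1 1 (-1) := pair (by decide) h0_1_1
      have h1_2_m2 : ¬ Z 1 2 (-2) := pair (by decide) h0_1_1
      have h1_1_2 : Z 1 1 2 := tri (by decide) h1_m1_0 h1_1_m1
      have h1_m1_m2 : Z 1 (-1) (-2) := tri (by decide) h1_m1_1 h1_1_0
      have h2_0_m1 : ¬ Z 2 0 (-1) := pair (by decide) h1_1_2
      have h2_0_1 : ¬ Z 2 0 1 := pair (by decide) h1_m1_m2
      have h1_0_2 : Z 1 0 2 := tri (by decide) h0_1_0 h2_0_m1
      have h1_0_m2 : Z 1 0 (-2) := tri (by decide) h0_1_0 h2_0_1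
      have h2_m2_m1 : ¬ Z 2 (-2) (-1) := pair (by decide) h1_0_2
      have h2_1_1 : ¬ Z 2 1 1 := pair (by decide) h1_0_m2
      have h2_1_2 : Z 2 1 2 := tri (by decide) h1_2_m2 h2_m2_m1
      have h1_m1_m1 : Z 1 (-1) (-1) := tri (by decide) h0_1_m1 h2_1_1
      have h1_0_m1 : ¬ Z 1 0 (-1) := pair (by decide) h2_1_2
      have h1_0_1 : ¬ Z 1 0 1 := pair (by decide) h1_m1_m1
      exact h1_0_1 (tri (by decide) h0_1_0 h1_0_m1)
    have h1_0_0 : Z 1 0 0 := tri (by decide) h0_1_m1 h0_1_1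
    exact pair (by decide) h0_0_1 h1_0_0
  by_cases h0_1_0 : Z 0 1 0
  · by_cases h1_m1_0 : Z 1 (-1) 0
    · have h1_0_m1 : ¬ Z 1 0 (-1) := pair (by decide) h0_1_0
      have h1_0_0 : ¬ Z 1 0 0 := pair (by decide) h0_1_0
      have h1_0_1 : ¬ Z 1 0 1 := pair (by decide) h0_1_0
      have h1_1_m1 : ¬ Z 1 1 (-1) := pair (by decide) h1_m1_0
      have h1_1_0 : ¬ Z 1 1 0 := pair (by decide) h1_m1_0
      have h1_1_1 : ¬ Z 1 1 1 := pair (by decide) h1_m1_0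
      have h1_m2_1 : Z 1 (-2) 1 := tri (by decide) h1_0_m1 h1_1_1
      have h1_m2_m1 : Z 1 (-2) (-1) := tri (by decide) h1_0_1 h1_1_m1
      have h0_1_2 : ¬ Z 0 1 2 := pair (by decide) h1_m2_1
      have h0_1_m2 : ¬ Z 0 1 (-2) := pair (by decide) h1_m2_m1
      have h0_2_m1 : Z 0 2 (-1) := tri (by decide) h0_1_2 h1_0_0
      have h0_2_1 : Z 0 2 1 := tri (by decide) h0_1_m2 h1_0_0
      have h1_m1_m2 : ¬ Z 1 (-1) (-2) := pair (by decide) h0_2_m1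
      have h1_m1_2 : ¬ Z 1 (-1) 2 := pair (by decide) h0_2_1
      have h1_m1_1 : Z 1 (-1) 1 := tri (by decide) h1_m1_m2 h1_1_0
      have h1_m1_m1 : Z 1 (-1) (-1) := tri (by decide) h1_m1_2 h1_1_0
      have h0_1_1 : ¬ Z 0 1 1 := pair (by decide) h1_m1_1
      have h0_1_m1 : ¬ Z 0 1 (-1) := pair (by decide) h1_m1_m1
      exact h1_0_0 (tri (by decide) h0_1_m1 h0_1_1)
    by_cases h1_1_0 : Z 1 1 0
    · have h1_0_m1 : ¬ Z 1 0 (-1) := pair (by decide) h0_1_0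
      have h1_0_0 : ¬ Z 1 0 0 := pair (by decide) h0_1_0
      have h1_0_1 : ¬ Z 1 0 1 := pair (by decide) h0_1_0
      have h1_m1_m1 : ¬ Z 1 (-1) (-1) := pair (by decide) h1_1_0
      have h1_m1_0 : ¬ Z 1 (-1) 0 := pair (by decide) h1_1_0
      have h1_m1_1 : ¬ Z 1 (-1) 1 := pair (by decide) h1_1_0
      have h1_2_1 : Z 1 2 1 := tri (by decide) h1_m1_1 h1_0_m1
      have h1_2_m1 : Z 1 2 (-1) := tri (by decide) h1_m1_m1 h1_0_1
      have h0_1_m2 : ¬ Z 0 1 (-2) := pair (by decide) h1_2_1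
      have h0_1_2 : ¬ Z 0 1 2 := pair (by decide) h1_2_m1
      have h0_2_1 : Z 0 2 1 := tri (by decide) h0_1_m2 h1_0_0
      have h0_2_m1 : Z 0 2 (-1) := tri (by decide) h0_1_2 h1_0_0
      have h1_1_m2 : ¬ Z 1 1 (-2) := pair (by decide) h0_2_1
      have h1_1_2 : ¬ Z 1 1 2 := pair (by decide) h0_2_m1
      have h1_1_1 : Z 1 1 1 := tri (by decide) h1_m1_0 h1_1_m2
      have h1_1_m1 : Z 1 1 (-1) := tri (by decide) h1_m1_0 h1_1_2
      have h0_1_m1 : ¬ Z 0 1 (-1) := pair (by decide) h1_1_1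
      have h0_1_1 : ¬ Z 0 1 1 := pair (by decide) h1_1_m1
      exact h1_0_0 (tri (by decide) h0_1_m1 h0_1_1)
    have h0_0_1 : Z 0 0 1 := tri (by decide) h1_m1_0 h1_1_0
    exact pair (by decide) h0_1_0 h0_0_1
  have h1_0_0 : Z 1 0 0 := tri (by decide) h0_0_1 h0_1_0
  by_cases h1_m1_0 : Z 1 (-1) 0
  · have h0_1_m1 : ¬ Z 0 1 (-1) := pair (by decide) h1_0_0
    have h0_1_0 : ¬ Z 0 1 0 := pair (by decide) h1_0_0
    have h0_1_1 : ¬ Z 0 1 1 := pair (by decide) h1_0_0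
    have h1_1_m1 : ¬ Z 1 1 (-1) := pair (by decide) h1_m1_0
    have h1_1_1 : ¬ Z 1 1 1 := pair (by decide) h1_m1_0
    have h2_2_m1 : ¬ Z 2 2 (-1) := pair (by decide) h1_m1_0
    have h2_2_1 : ¬ Z 2 2 1 := pair (by decide) h1_m1_0
    have h2_m1_m1 : Z 2 (-1) (-1) := tri (by decide) h0_1_m1 h1_1_1
    have h2_m1_1 : Z 2 (-1) 1 := tri (by decide) h0_1_1 h1_1_m1
    have h1_0_2 : ¬ Z 1 0 2 := pair (by decide) h2_m1_m1
    have h1_0_m2 : ¬ Z 1 0 (-2) := pair (by decide) h2_m1_1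
    have h2_0_m1 : Z 2 0 (-1) := tri (by decide) h0_1_0 h1_0_2
    have h2_0_1 : Z 2 0 1 := tri (by decide) h0_1_0 h1_0_m2
    have h1_m2_2 : ¬ Z 1 (-2) 2 := pair (by decide) h2_0_m1
    have h1_m2_m2 : ¬ Z 1 (-2) (-2) := pair (by decide) h2_0_1
    have h2_m1_m2 : Z 2 (-1) (-2) := tri (by decide) h1_m2_2 h2_2_1
    have h2_m1_2 : Z 2 (-1) 2 := tri (by decide) h1_m2_m2 h2_2_m1
    have h1_0_1 : ¬ Z 1 0 1 := pair (by decide) h2_m1_m2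
    have h1_0_m1 : ¬ Z 1 0 (-1) := pair (by decide) h2_m1_2
    exact h1_0_1 (tri (by decide) h0_1_0 h1_0_m1)
  by_cases h1_1_0 : Z 1 1 0
  · have h0_1_m1 : ¬ Z 0 1 (-1) := pair (by decide) h1_0_0
    have h0_1_0 : ¬ Z 0 1 0 := pair (by decide) h1_0_0
    have h0_1_1 : ¬ Z 0 1 1 := pair (by decide) h1_0_0
    have h1_m1_m1 : ¬ Z 1 (-1) (-1) := pair (by decide) h1_1_0
    have h1_m1_0 : ¬ Z 1 (-1) 0 := pair (by decide) h1_1_0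
    have h1_m1_1 : ¬ Z 1 (-1) 1 := pair (by decide) h1_1_0
    have h2_1_1 : Z 2 1 1 := tri (by decide) h0_1_m1 h1_m1_m1
    have h2_1_m1 : Z 2 1 (-1) := tri (by decide) h0_1_1 h1_m1_1
    have h1_0_m2 : ¬ Z 1 0 (-2) := pair (by decide) h2_1_1
    have h1_0_2 : ¬ Z 1 0 2 := pair (by decide) h2_1_m1
    have h2_0_1 : Z 2 0 1 := tri (by decide) h0_1_0 h1_0_m2
    have h2_0_m1 : Z 2 0 (-1) := tri (by decide) h0_1_0 h1_0_2
    have h1_1_m2 : ¬ Z 1 1 (-2) := pair (by decide) h2_0_1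
    have h1_1_2 : ¬ Z 1 1 2 := pair (by decide) h2_0_m1
    have h1_1_1 : Z 1 1 1 := tri (by decide) h1_m1_0 h1_1_m2
    have h1_1_m1 : Z 1 1 (-1) := tri (by decide) h1_m1_0 h1_1_2
    have h1_0_m1 : ¬ Z 1 0 (-1) := pair (by decide) h1_1_1
    have h1_0_1 : ¬ Z 1 0 1 := pair (by decide) h1_1_m1
    exact h1_0_1 (tri (by decide) h0_1_0 h1_0_m1)
  have h0_0_1 : Z 0 0 1 := tri (by decide) h1_m1_0 h1_1_0
  exact pair (by decide) h1_0_0 h0_0_1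

/-- The real vector with given integer coordinates. -/
def vec (a b c : ℤ) : V3 := !₂[(a : ℝ), (b : ℝ), (c : ℝ)]

theorem vec_ne {a b c : ℤ} (h : ¬ (a = 0 ∧ b = 0 ∧ c = 0)) : vec a b c ≠ 0 := by
  intro h0
  apply h
  have h1 := congrArg (fun v : V3 => v 0) h0
  have h2 := congrArg (fun v : V3 => v 1) h0
  have h3 := congrArg (fun v : V3 => v 2) h0
  simp [vec] at h1 h2 h3
  exact ⟨h1, h2, h3⟩

theorem vec_inner {a b c d e f : ℤ} (h : a * d + b * e + c * f = 0) :
    inner ℝ (vec a b c) (vec d e f) = 0 := by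
  have : (a : ℝ) * d + b * e + c * f = 0 := by exact_mod_cast h
  simp [vec, PiLp.inner_apply, Fin.sum_univ_three]
  linarith

/-- A frame whose entries are the normalizations of an orthogonal triple. -/
theorem exists_frame (u v w : V3) (hu : u ≠ 0) (hv : v ≠ 0) (hw : w ≠ 0)
    (huv : inner ℝ u v = 0) (huw : inner ℝ u w = 0) (hvw : inner ℝ v w = 0) :
    ∃ a : Frame, a.1 0 = (‖u‖⁻¹ : ℝ) • u ∧ a.1 1 = (‖v‖⁻¹ : ℝ) • v ∧
      a.1 2 = (‖w‖⁻¹ : ℝ) • w := by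
  have hvu : inner ℝ v u = 0 := by rw [real_inner_comm]; exact huv
  have hwu : inner ℝ w u = 0 := by rw [real_inner_comm]; exact huw
  have hwv : inner ℝ w v = 0 := by rw [real_inner_comm]; exact hvw
  have n1 : ∀ x : V3, x ≠ 0 → ‖(‖x‖⁻¹ : ℝ) • x‖ = 1 := by
    intro x hx
    rw [norm_smul, norm_inv, norm_norm, inv_mul_cancel₀ (norm_ne_zero_iff.mpr hx)]
  refine ⟨⟨![(‖u‖⁻¹ : ℝ) • u, (‖v‖⁻¹ : ℝ) • v, (‖w‖⁻¹ : ℝ) • w], ?_, ?_⟩, rfl, rfl, rfl⟩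
  · intro i
    fin_cases i
    · exact n1 u hu
    · exact n1 v hv
    · exact n1 w hw
  · intro i j hij
    fin_cases i <;> fin_cases j <;>
      first
      | exact absurd rfl hij
      | simp [inner_smul_left, inner_smul_right, huv, huw, hvw, hvu, hwu, hwv]

/-- Members of `Tset` have exactly one vanishing coordinate. -/
theorem tset_exact (t : Fin 3 → ℕ) (ht : t ∈ Tset) :
    (t 0 = 0 ∨ t 1 = 0 ∨ t 2 = 0) ∧ ¬ (t 0 = 0 ∧ t 1 = 0) ∧
      ¬ (t 0 = 0 ∧ t 2 = 0) ∧ ¬ (t 1 = 0 ∧ t 2 = 0) := by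
  rcases ht with rfl | rfl | rfl <;> simp

/-- There is no frame function on the set of all frames: no `l : 𝓕 → T` such that whenever
frames `a`, `a'` satisfy `aᵢ = ±a'ⱼ`, one has `lᵢ(a) = lⱼ(a')`. -/
theorem no_frame_function_on_all_frames :
    ¬ ∃ l : Frame → ↥Tset,
        ∀ a a' : Frame, ∀ i j : Fin 3,
          SameLine (a.1 i) (a'.1 j) → (l a).1 i = (l a').1 j := by
  rintro ⟨l, hl⟩
  let Z : V3 → Prop := fun u => ∃ a : Frame, ∃ i, a.1 i = (‖u‖⁻¹ : ℝ) • u ∧ (l a).1 i = 0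
  have hZ : ∀ (a : Frame) (i : Fin 3) (u : V3), a.1 i = (‖u‖⁻¹ : ℝ) • u →
      (Z u ↔ (l a).1 i = 0) := by
    intro a i u h
    constructor
    · rintro ⟨b, j, hb, h0⟩
      rw [hl a b i j (Or.inl (h.trans hb.symm)), h0]
    · intro h0
      exact ⟨a, i, h, h0⟩
  have main : ∀ u v w : V3, u ≠ 0 → v ≠ 0 → w ≠ 0 → inner ℝ u v = 0 → inner ℝ u w = 0 →
      inner ℝ v w = 0 → (Z u ∨ Z v ∨ Z w) ∧ ¬ (Z u ∧ Z v) := by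
    intro u v w hu hv hw h1 h2 h3
    obtain ⟨a, ha, hb, hc⟩ := exists_frame u v w hu hv hw h1 h2 h3
    rw [hZ a 0 u ha, hZ a 1 v hb, hZ a 2 w hc]
    have := tset_exact _ (l a).2
    exact ⟨this.1, this.2.1⟩
  refine ks_core (fun a b c => Z (vec a b c)) ?_ ?_
  · rintro a b c d e f ⟨hu, hv, huv⟩ h1 h2
    have hw : ¬ (b * f - c * e = 0 ∧ c * d - a * f = 0 ∧ a * e - b * d = 0) := by
      rintro ⟨p, q, r⟩
      -- Lagrange: |u|²|v|² = |u × v|² + (u ⬝ v)²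
      have key : (a * a + b * b + c * c) * (d * d + e * e + f * f) = 0 := by
        linear_combination (b * f - c * e) * p + (c * d - a * f) * q + (a * e - b * d) * r
          + (a * d + b * e + c * f) * huv
      rcases mul_eq_zero.mp key with k | k
      · apply hu
        refine ⟨?_, ?_, ?_⟩ <;> nlinarith [mul_self_nonneg a, mul_self_nonneg b, mul_self_nonneg c]
      · apply hv
        refine ⟨?_, ?_, ?_⟩ <;> nlinarith [mul_self_nonneg d, mul_self_nonneg e, mul_self_nonneg f]
    exact (main (vec a b c) (vec d e f) (vec _ _ _) (vec_ne hu) (vec_ne hv) (vec_ne hw)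
      (vec_inner huv) (vec_inner (by ring)) (vec_inner (by ring))).2 ⟨h1, h2⟩
  · rintro a b c d e f g h k ⟨hu, hv, hw, h1, h2, h3⟩ hzu hzv
    have := (main _ _ _ (vec_ne hu) (vec_ne hv) (vec_ne hw) (vec_inner h1) (vec_inner h2)
      (vec_inner h3)).1
    exact (this.resolve_left hzu).resolve_left hzv
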